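/- Define P₂(n;λ) = (336 + 32n² + 16n(13+2λ) + λ(46+5λ))·(576 + 32n² + 16n(17+2λ) + λ(78+5λ)). Then for every integer n ≥ 20 and every λ ∈ ℂ with Re λ ≥ 0, P₂(n;λ) ≠ 0. -/

import Mathlib

/-- The polynomial `P₂(n;λ)`. -/
noncomputable def P2 (n : ℕ) (lam : ℂ) : ℂ :=
  (336 + 32 * (n : ℂ) ^ 2 + 16 * (n : ℂ) * (13 + 2 * lam) + lam * (46 + 5 * lam))
    * (576 + 32 * (n : ℂ) ^ 2 + 16 * (n : ℂ) * (17 + 2 * lam) + lam * (78 + 5 * lam))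

/-- A real quadratic with positive coefficients has no zero in the closed right half-plane. -/
theorem quadratic_ne_zero_of_re_nonneg {a b c : ℝ} (ha : 0 < a) (hb : 0 < b) (hc : 0 < c)
    {z : ℂ} (hz : 0 ≤ z.re) : (a : ℂ) * z ^ 2 + b * z + c ≠ 0 := by
  intro h
  have hre := congrArg Complex.re h
  have him := congrArg Complex.im h
  simp [pow_two] at hre him
  have hy : z.im * (2 * a * z.re + b) = 0 := by linarith
  have hpos : 0 < 2 * a * z.re + b := by positivity
  have hy0 : z.im = 0 := (mul_eq_zero.mp hy).resolve_right hpos.ne'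
  rw [hy0] at hre
  have : 0 < a * (z.re * z.re) + b * z.re + c := by positivity
  linarith

/-- `P₂(n;λ) ≠ 0` for all integers `n ≥ 20` and all `λ` with `Re λ ≥ 0`. -/
theorem stmt_14 (n : ℕ) (hn : 20 ≤ n) (lam : ℂ) (hlam : 0 ≤ lam.re) :
    P2 n lam ≠ 0 := by
  refine mul_ne_zero ?_ ?_
  · have h := quadratic_ne_zero_of_re_nonneg (a := 5) (b := 32 * n + 46)
      (c := 336 + 32 * n ^ 2 + 208 * n) (by positivity) (by positivity) (by positivity) hlam
    contrapose! h
    push_cast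
    linear_combination h
  · have h := quadratic_ne_zero_of_re_nonneg (a := 5) (b := 32 * n + 78)
      (c := 576 + 32 * n ^ 2 + 272 * n) (by positivity) (by positivity) (by positivity) hlam
    contrapose! h
    push_cast
    linear_combination h
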